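/- For 0 < |q| < 1: ∑_{n=0}^{∞} (−1)^n (q; q²)_n (q^{2n} − 1) q^{3n² − 2n} / (q²; q²)_{2n} = [(q; q²)_∞ / (q²; q²)_∞] · [ (q^{13}, q^{17}, q^{30}; q^{30})_∞ − (q^{11}, q^{19}, q^{30}; q^{30})_∞ + q(q^{7}, q^{23}, q^{30}; q^{30})_∞ − q³(q, q^{29}, q^{30}; q^{30})_∞ ]. -/

import Mathlib

noncomputable def qp (q x : ℂ) (n : ℕ) : ℂ := ∏ i ∈ Finset.range n, (1 - x * q ^ i)

noncomputable def qpInf (q x : ℂ) : ℂ := ∏' i : ℕ, (1 - x * q ^ i)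

noncomputable def tp (Q a b : ℂ) : ℂ := qpInf Q a * qpInf Q b * qpInf Q Q


open Filter Topology

lemma qp_succ (Q x : ℂ) (n : ℕ) : qp Q x (n + 1) = qp Q x n * (1 - x * Q ^ n) := by
  simp [qp, Finset.prod_range_succ]

lemma qp_zero (Q x : ℂ) : qp Q x 0 = 1 := by simp [qp]

lemma summable_aux {Q : ℂ} (hQ : ‖Q‖ < 1) (x : ℂ) :
    Summable fun i : ℕ => ‖-(x * Q ^ i)‖ := by
  simp only [norm_neg, norm_mul, norm_pow]
  exact (summable_geometric_of_lt_one (norm_nonneg _) hQ).mul_left _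

lemma qp_tendsto {Q : ℂ} (hQ : ‖Q‖ < 1) (x : ℂ) :
    Tendsto (qp Q x) atTop (𝓝 (qpInf Q x)) := by
  have h : Multipliable fun i : ℕ => (1 + -(x * Q ^ i)) :=
    multipliable_one_add_of_summable (summable_aux hQ x)
  have := h.tendsto_prod_tprod_nat
  simp only [← sub_eq_add_neg] at this
  exact this

lemma one_sub_pow_ne {Q : ℂ} (hQ : ‖Q‖ < 1) (i : ℕ) : 1 - Q * Q ^ i ≠ 0 := by
  intro h
  have h2 : Q ^ (i + 1) = 1 := by rw [pow_succ']; linear_combination -h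
  have h3 : ‖Q‖ ^ (i + 1) = 1 := by rw [← norm_pow, h2, norm_one]
  have : ‖Q‖ ^ (i + 1) < 1 := pow_lt_one₀ (norm_nonneg _) hQ (by omega)
  linarith

lemma qp_ne {Q : ℂ} (hQ : ‖Q‖ < 1) (n : ℕ) : qp Q Q n ≠ 0 :=
  Finset.prod_ne_zero_iff.mpr fun i _ => one_sub_pow_ne hQ i

lemma qpInf_ne {Q : ℂ} (hQ : ‖Q‖ < 1) : qpInf Q Q ≠ 0 := by
  have := tprod_one_add_ne_zero_of_summable (f := fun i : ℕ => -(Q * Q ^ i))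
    (fun i => by rw [← sub_eq_add_neg]; exact one_sub_pow_ne hQ i) (summable_aux hQ Q)
  simpa only [qpInf, ← sub_eq_add_neg] using this

lemma qp_bdd {Q : ℂ} (hQ : ‖Q‖ < 1) (x : ℂ) : ∃ K, 0 ≤ K ∧ ∀ n, ‖qp Q x n‖ ≤ K := by
  obtain ⟨K, hK⟩ := (Metric.isBounded_range_of_tendsto _ (qp_tendsto hQ x)).exists_norm_le
  exact ⟨K, (norm_nonneg _).trans (hK _ ⟨0, rfl⟩), fun n => hK _ ⟨n, rfl⟩⟩

/-- Reciprocal of the finite Pochhammer symbol, extended by zero to negative integers. -/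
noncomputable def PP (Q : ℂ) (c : ℤ) : ℂ := if c < 0 then 0 else (qp Q Q c.toNat)⁻¹

lemma PP_neg (Q : ℂ) {c : ℤ} (hc : c < 0) : PP Q c = 0 := by simp [PP, hc]

lemma PP_nat (Q : ℂ) (n : ℕ) : PP Q n = (qp Q Q n)⁻¹ := by simp [PP]

lemma PP_step {Q : ℂ} (hQ : ‖Q‖ < 1) (c : ℤ) :
    PP Q (c - 1) = (1 - Q ^ c) * PP Q c := by
  rcases lt_trichotomy c 0 with h | h | h
  · rw [PP_neg _ h, PP_neg _ (by omega)]; simp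
  · subst h; rw [PP_neg _ (by omega)]; simp
  · obtain ⟨n, rfl⟩ : ∃ n : ℕ, c = (n + 1 : ℕ) := ⟨(c - 1).toNat, by omega⟩
    have e : ((n + 1 : ℕ) : ℤ) - 1 = n := by push_cast; ring
    rw [e, PP_nat, PP_nat, qp_succ, zpow_natCast, pow_succ']
    have h1 := one_sub_pow_ne hQ n
    have h2 := qp_ne hQ n
    field_simp

lemma PP_bdd {Q : ℂ} (hQ : ‖Q‖ < 1) : ∃ K, 0 ≤ K ∧ ∀ c, ‖PP Q c‖ ≤ K := by
  have ht := (qp_tendsto hQ Q).inv₀ (qpInf_ne hQ)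
  obtain ⟨K, hK⟩ := (Metric.isBounded_range_of_tendsto _ ht).exists_norm_le
  have h0 : 0 ≤ K := (norm_nonneg _).trans (hK _ ⟨0, rfl⟩)
  refine ⟨K, h0, fun c => ?_⟩
  rcases lt_or_ge c 0 with h | h
  · rw [PP_neg _ h]; simpa
  · lift c to ℕ using h
    rw [PP_nat]; exact hK _ ⟨c, rfl⟩

lemma PP_tendsto {Q : ℂ} (hQ : ‖Q‖ < 1) :
    Tendsto (PP Q) atTop (𝓝 (qpInf Q Q)⁻¹) := by
  have ht := (qp_tendsto hQ Q).inv₀ (qpInf_ne hQ)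
  have h2 : Tendsto (fun c : ℤ => c.toNat) atTop atTop := by
    rw [tendsto_atTop]
    intro b
    filter_upwards [eventually_ge_atTop (b : ℤ)] with c hc
    omega
  refine (ht.comp h2).congr' ?_
  filter_upwards [eventually_ge_atTop 0] with c hc
  simp [PP, not_lt.mpr hc]

lemma summable_PP {ι : Type*} {Q : ℂ} (hQ : ‖Q‖ < 1) {g : ι → ℂ} (hg : Summable g) (u v : ι → ℤ) :
    Summable fun k => g k * (PP Q (u k) * PP Q (v k)) := by
  obtain ⟨K, h0, hK⟩ := PP_bdd hQ
  refine Summable.of_norm_bounded (hg.norm.mul_right (K * K)) fun k => ?_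
  rw [norm_mul, norm_mul]
  gcongr
  · exact hK _
  · exact hK _

lemma tsum_shift (f : ℤ → ℂ) (c : ℤ) : ∑' k : ℤ, f (k + c) = ∑' k, f k :=
  (Equiv.addRight c).tsum_eq f

lemma tsum_flip (f : ℤ → ℂ) : ∑' k : ℤ, f (-k) = ∑' k, f k :=
  (Equiv.neg ℤ).tsum_eq f

lemma summable_geo {r : ℝ} (h0 : 0 ≤ r) (h1 : r < 1) : Summable fun k : ℤ => r ^ k.natAbs := by
  refine Summable.of_nat_of_neg ?_ ?_ <;> simpa using summable_geometric_of_lt_one h0 h1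

lemma summable_sq {q : ℂ} (h0 : 0 < ‖q‖) (h1 : ‖q‖ < 1) (a b c : ℤ) (ha : 0 < a) :
    Summable fun k : ℤ => q ^ (a * k ^ 2 + b * k + c) := by
  refine Summable.of_norm_bounded
    ((summable_geo h0.le h1).mul_left (‖q‖ ^ (c - (|b| + 1) ^ 2))) fun k => ?_
  rw [norm_zpow, ← zpow_natCast, ← zpow_add₀ h0.ne']
  apply zpow_le_zpow_right_of_le_one₀ h0 h1.le
  rw [Int.natCast_natAbs]
  have h2 : a * k ^ 2 ≥ k ^ 2 := by nlinarith [sq_nonneg k]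
  have h3 : b * k ≥ - (|b| * |k|) := by rw [← abs_mul]; exact neg_abs_le _
  have h4 : k ^ 2 = |k| ^ 2 := (sq_abs k).symm
  have h5 := abs_nonneg k
  have h6 := abs_nonneg b
  rw [h4] at h2
  nlinarith [sq_nonneg (|k| - (|b| + 1)), mul_nonneg h5 h6, sq_nonneg (|k|-1)]


/-- q-Pascal, first form. -/
lemma pas1 {Q : ℂ} (hQ0 : Q ≠ 0) (hQ : ‖Q‖ < 1) (a b : ℤ) :
    (1 - Q ^ (a + b)) * (PP Q a * PP Q b)
      = PP Q a * PP Q (b - 1) + Q ^ b * (PP Q (a - 1) * PP Q b) := by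
  rw [PP_step hQ a, PP_step hQ b, zpow_add₀ hQ0]; ring

/-- q-Pascal, second form. -/
lemma pas2 {Q : ℂ} (hQ0 : Q ≠ 0) (hQ : ‖Q‖ < 1) (a b : ℤ) :
    (1 - Q ^ (a + b)) * (PP Q a * PP Q b)
      = PP Q (a - 1) * PP Q b + Q ^ a * (PP Q a * PP Q (b - 1)) := by
  rw [PP_step hQ a, PP_step hQ b, zpow_add₀ hQ0]; ring

noncomputable def SS (Q : ℂ) (n : ℤ) : ℂ :=
  ∑' k : ℤ, Q ^ (3 * k ^ 2 + (-1) * k + 0) * (PP Q (n - 3 * k) * PP Q (n + 3 * k))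
  - ∑' k : ℤ, Q ^ (3 * k ^ 2 + (-1) * k + 0) * (PP Q (n - (3 * k - 1)) * PP Q (n + (3 * k - 1)))

noncomputable def TT (Q : ℂ) (n : ℤ) : ℂ :=
  ∑' k : ℤ, Q ^ (3 * k ^ 2 + 2 * k + 0) * (PP Q (n - 3 * k - 1) * PP Q (n + 3 * k))
  - ∑' k : ℤ, Q ^ (3 * k ^ 2 + 2 * k + 0) * (PP Q (n - 3 * k - 2) * PP Q (n + 3 * k + 1))

noncomputable def VV (Q : ℂ) (n : ℤ) : ℂ :=
  ∑' k : ℤ, Q ^ (3 * k ^ 2 + (-2) * k + 0) * (PP Q (n - 3 * k) * PP Q (n + 3 * k))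
  - ∑' k : ℤ, Q ^ (3 * k ^ 2 + (-4) * k + 1) * (PP Q (n - (3 * k - 1)) * PP Q (n + (3 * k - 1)))

lemma SS_TT {Q : ℂ} (h0 : 0 < ‖Q‖) (hQ : ‖Q‖ < 1) (n : ℤ) :
    (1 - Q ^ (2 * n)) * SS Q n = Q ^ n * TT Q n := by
  have hQ0 : Q ≠ 0 := norm_pos_iff.mp h0
  have sm := fun b c u v => summable_PP hQ (summable_sq h0 hQ 3 b c (by norm_num)) u v
  have e2 : ∑' k : ℤ, Q ^ (3 * k ^ 2 + 2 * k + 0) * (PP Q (n - 3 * k - 2) * PP Q (n + 3 * k + 1))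
      = ∑' k : ℤ, Q ^ (3 * k ^ 2 + (-4) * k + 1) *
        (PP Q (n - 3 * k + 1) * PP Q (n + 3 * k - 2)) := by
    rw [← tsum_shift _ (-1)]
    refine tsum_congr fun k => ?_
    congr 1
    · congr 1; ring
    · congr 2 <;> ring
  unfold SS TT
  rw [e2, ← Summable.tsum_sub (sm _ _ _ _) (sm _ _ _ _), ← Summable.tsum_sub (sm _ _ _ _) (sm _ _ _ _),
    ← tsum_mul_left, ← tsum_mul_left]
  refine tsum_congr fun k => ?_
  have p1 := pas1 hQ0 hQ (n - 3 * k) (n + 3 * k)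
  have p2 := pas2 hQ0 hQ (n - (3 * k - 1)) (n + (3 * k - 1))
  rw [show n - 3 * k + (n + 3 * k) = 2 * n by ring] at p1
  rw [show n - (3 * k - 1) + (n + (3 * k - 1)) = 2 * n by ring,
    show n - (3 * k - 1) - 1 = n - 3 * k by ring, 
    show n + (3 * k - 1) = n + 3 * k - 1 by ring,
    show n + 3 * k - 1 - 1 = n + 3 * k - 2 by ring,
    show n - (3 * k - 1) = n - 3 * k + 1 by ring] at p2
  rw [show n + (3 * k - 1) = n + 3 * k - 1 by ring, 
    show n - (3 * k - 1) = n - 3 * k + 1 by ring]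
  have x1 : Q ^ (3 * k ^ 2 + (-1) * k + 0) * Q ^ (n + 3 * k) = Q ^ n * Q ^ (3 * k ^ 2 + 2 * k + 0) := by
    rw [← zpow_add₀ hQ0, ← zpow_add₀ hQ0]; congr 1; ring
  have x2 : Q ^ (3 * k ^ 2 + (-1) * k + 0) * Q ^ (n - 3 * k + 1)
      = Q ^ n * Q ^ (3 * k ^ 2 + (-4) * k + 1) := by
    rw [← zpow_add₀ hQ0, ← zpow_add₀ hQ0]; congr 1; ring
  linear_combination Q ^ (3 * k ^ 2 + (-1) * k + 0) * (p1 - p2) +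
    x1 * (PP Q (n - 3 * k - 1) * PP Q (n + 3 * k))
    - x2 * (PP Q (n - 3 * k + 1) * PP Q (n + 3 * k - 2))

lemma TT_SS {Q : ℂ} (h0 : 0 < ‖Q‖) (hQ : ‖Q‖ < 1) (n : ℤ) :
    (1 - Q ^ (2 * n - 1)) * TT Q n = Q ^ (n - 1) * SS Q (n - 1) := by
  have hQ0 : Q ≠ 0 := norm_pos_iff.mp h0
  have sm := fun b c u v => summable_PP hQ (summable_sq h0 hQ 3 b c (by norm_num)) u v
  have e2 : ∑' k : ℤ, Q ^ (3 * k ^ 2 + (-1) * k + 0) *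
        (PP Q (n - 1 - (3 * k - 1)) * PP Q (n - 1 + (3 * k - 1)))
      = ∑' k : ℤ, Q ^ (3 * k ^ 2 + 5 * k + 2) *
        (PP Q (n - 3 * k - 3) * PP Q (n + 3 * k + 1)) := by
    rw [← tsum_shift _ 1]
    refine tsum_congr fun k => ?_
    congr 1
    · congr 1; ring
    · congr 2 <;> ring
  unfold SS TT
  rw [e2, ← Summable.tsum_sub (sm _ _ _ _) (sm _ _ _ _), ← Summable.tsum_sub (sm _ _ _ _) (sm _ _ _ _),
    ← tsum_mul_left, ← tsum_mul_left]
  refine tsum_congr fun k => ?_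
  have p1 := pas2 hQ0 hQ (n - 3 * k - 1) (n + 3 * k)
  have p2 := pas1 hQ0 hQ (n - 3 * k - 2) (n + 3 * k + 1)
  rw [show n - 3 * k - 1 + (n + 3 * k) = 2 * n - 1 by ring,
    show n - 3 * k - 1 - 1 = n - 3 * k - 2 by ring] at p1
  rw [show n - 3 * k - 2 + (n + 3 * k + 1) = 2 * n - 1 by ring,
    show n - 3 * k - 2 - 1 = n - 3 * k - 3 by ring, 
    show n + 3 * k + 1 - 1 = n + 3 * k by ring] at p2
  rw [show n - 1 - 3 * k = n - 3 * k - 1 by ring, 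
    show n - 1 + 3 * k = n + 3 * k - 1 by ring]
  have x1 : Q ^ (3 * k ^ 2 + 2 * k + 0) * Q ^ (n - 3 * k - 1)
      = Q ^ (n - 1) * Q ^ (3 * k ^ 2 + (-1) * k + 0) := by
    rw [← zpow_add₀ hQ0, ← zpow_add₀ hQ0]; congr 1; ring
  have x2 : Q ^ (3 * k ^ 2 + 2 * k + 0) * Q ^ (n + 3 * k + 1)
      = Q ^ (n - 1) * Q ^ (3 * k ^ 2 + 5 * k + 2) := by
    rw [← zpow_add₀ hQ0, ← zpow_add₀ hQ0]; congr 1; ring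
  linear_combination Q ^ (3 * k ^ 2 + 2 * k + 0) * (p1 - p2) +
    x1 * (PP Q (n - 3 * k - 1) * PP Q (n + 3 * k - 1))
    - x2 * (PP Q (n - 3 * k - 3) * PP Q (n + 3 * k + 1))

lemma VV_TT {Q : ℂ} (h0 : 0 < ‖Q‖) (hQ : ‖Q‖ < 1) (n : ℤ) :
    (1 - Q ^ (2 * n)) * VV Q n = TT Q n := by
  have hQ0 : Q ≠ 0 := norm_pos_iff.mp h0
  have sm := fun b c u v => summable_PP hQ (summable_sq h0 hQ 3 b c (by norm_num)) u v
  have e1 : ∑' k : ℤ, Q ^ (3 * k ^ 2 + 2 * k + 0) * (PP Q (n - 3 * k - 1) * PP Q (n + 3 * k))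
      = ∑' k : ℤ, Q ^ (3 * k ^ 2 + (-2) * k + 0) * (PP Q (n - 3 * k) * PP Q (n + 3 * k - 1)) := by
    rw [← tsum_flip]
    refine tsum_congr fun k => ?_
    rw [mul_comm (PP Q _)]
    congr 1
    · congr 1; ring
    · congr 2 <;> ring
  have e2 : ∑' k : ℤ, Q ^ (3 * k ^ 2 + 2 * k + 0) * (PP Q (n - 3 * k - 2) * PP Q (n + 3 * k + 1))
      = ∑' k : ℤ, Q ^ (3 * k ^ 2 + (-4) * k + 1) *
        (PP Q (n - 3 * k + 1) * PP Q (n + 3 * k - 2)) := by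
    rw [← tsum_shift _ (-1)]
    refine tsum_congr fun k => ?_
    congr 1
    · congr 1; ring
    · congr 2 <;> ring
  have e3 : ∑' k : ℤ, Q ^ (3 * k ^ 2 + 1 * k + n) * (PP Q (n - 3 * k - 1) * PP Q (n + 3 * k))
      = ∑' k : ℤ, Q ^ (3 * k ^ 2 + (-1) * k + n) * (PP Q (n - 3 * k) * PP Q (n + 3 * k - 1)) := by
    rw [← tsum_flip]
    refine tsum_congr fun k => ?_
    rw [mul_comm (PP Q _)]
    congr 1
    · congr 1; ring
    · congr 2 <;> ring
  have e4 : (1 - Q ^ (2 * n)) * ∑' k : ℤ, Q ^ (3 * k ^ 2 + (-2) * k + 0) *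
        (PP Q (n - 3 * k) * PP Q (n + 3 * k))
      = ∑' k : ℤ, Q ^ (3 * k ^ 2 + (-2) * k + 0) * (PP Q (n - 3 * k) * PP Q (n + 3 * k - 1))
       + ∑' k : ℤ, Q ^ (3 * k ^ 2 + 1 * k + n) * (PP Q (n - 3 * k - 1) * PP Q (n + 3 * k)) := by
    rw [← Summable.tsum_add (sm _ _ _ _) (sm _ _ _ _), ← tsum_mul_left]
    refine tsum_congr fun k => ?_
    have p1 := pas1 hQ0 hQ (n - 3 * k) (n + 3 * k)
    rw [show n - 3 * k + (n + 3 * k) = 2 * n by ring] at p1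
    have x1 : Q ^ (3 * k ^ 2 + (-2) * k + 0) * Q ^ (n + 3 * k) = Q ^ (3 * k ^ 2 + 1 * k + n) := by
      rw [← zpow_add₀ hQ0]; congr 1; ring
    rw [← x1]
    linear_combination Q ^ (3 * k ^ 2 + (-2) * k + 0) * p1
  have e5 : (1 - Q ^ (2 * n)) * ∑' k : ℤ, Q ^ (3 * k ^ 2 + (-4) * k + 1) *
        (PP Q (n - (3 * k - 1)) * PP Q (n + (3 * k - 1)))
      = ∑' k : ℤ, Q ^ (3 * k ^ 2 + (-4) * k + 1) * (PP Q (n - 3 * k + 1) * PP Q (n + 3 * k - 2))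
       + ∑' k : ℤ, Q ^ (3 * k ^ 2 + (-1) * k + n) * (PP Q (n - 3 * k) * PP Q (n + 3 * k - 1)) := by
    rw [← Summable.tsum_add (sm _ _ _ _) (sm _ _ _ _), ← tsum_mul_left]
    refine tsum_congr fun k => ?_
    have p1 := pas1 hQ0 hQ (n - 3 * k + 1) (n + 3 * k - 1)
    rw [show n - 3 * k + 1 + (n + 3 * k - 1) = 2 * n by ring,
      show n - 3 * k + 1 - 1 = n - 3 * k by ring,
      show n + 3 * k - 1 - 1 = n + 3 * k - 2 by ring] at p1
    rw [show n + (3 * k - 1) = n + 3 * k - 1 by ring, 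
      show n - (3 * k - 1) = n - 3 * k + 1 by ring]
    have x1 : Q ^ (3 * k ^ 2 + (-4) * k + 1) * Q ^ (n + 3 * k - 1)
        = Q ^ (3 * k ^ 2 + (-1) * k + n) := by
      rw [← zpow_add₀ hQ0]; congr 1; ring
    rw [← x1]
    linear_combination Q ^ (3 * k ^ 2 + (-4) * k + 1) * p1
  unfold VV TT
  rw [mul_sub, e4, e5, e1, e2, e3]
  ring

lemma one_sub_zpow_ne {Q : ℂ} (hQ : ‖Q‖ < 1) {i : ℤ} (hi : 0 < i) : 1 - Q ^ i ≠ 0 := by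
  obtain ⟨n, rfl⟩ : ∃ n : ℕ, i = (n + 1 : ℕ) := ⟨(i - 1).toNat, by omega⟩
  rw [zpow_natCast, pow_succ']
  exact one_sub_pow_ne hQ n

lemma SS_zero (Q : ℂ) : SS Q 0 = 1 := by
  unfold SS
  rw [tsum_eq_single 0, tsum_eq_single 0]
  · simp [PP, qp_zero]
  · intro k hk
    rcases lt_or_gt_of_ne hk with h | h
    · rw [PP_neg Q (c := 0 + (3 * k - 1)) (by omega)]; simp
    · rw [PP_neg Q (c := 0 - (3 * k - 1)) (by omega)]; simp
  · intro k hk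
    rcases lt_or_gt_of_ne hk with h | h
    · rw [PP_neg Q (c := 0 + (3 * k)) (by omega)]; simp
    · rw [PP_neg Q (c := 0 - (3 * k)) (by omega)]; simp

lemma VV_zero (Q : ℂ) : VV Q 0 = 1 := by
  unfold VV
  rw [tsum_eq_single 0, tsum_eq_single 0]
  · simp [PP, qp_zero]
  · intro k hk
    rcases lt_or_gt_of_ne hk with h | h
    · rw [PP_neg Q (c := 0 + (3 * k - 1)) (by omega)]; simp
    · rw [PP_neg Q (c := 0 - (3 * k - 1)) (by omega)]; simp
  · intro k hk
    rcases lt_or_gt_of_ne hk with h | h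
    · rw [PP_neg Q (c := 0 + (3 * k)) (by omega)]; simp
    · rw [PP_neg Q (c := 0 - (3 * k)) (by omega)]; simp

lemma SS_eq {Q : ℂ} (h0 : 0 < ‖Q‖) (hQ : ‖Q‖ < 1) (n : ℕ) :
    SS Q n = Q ^ (n ^ 2) / qp Q Q (2 * n) := by
  have hQ0 : Q ≠ 0 := norm_pos_iff.mp h0
  induction n with
  | zero => simpa [qp_zero] using SS_zero Q
  | succ n ih =>
    have a1 := SS_TT h0 hQ (n + 1 : ℕ)
    have a2 := TT_SS h0 hQ (n + 1 : ℕ)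
    rw [show ((n + 1 : ℕ) : ℤ) - 1 = n by push_cast; ring, ih] at a2
    rw [show 2 * ((n + 1 : ℕ) : ℤ) - 1 = (2 * n + 1 : ℕ) by push_cast; ring] at a2
    rw [show 2 * ((n + 1 : ℕ) : ℤ) = (2 * n + 1 + 1 : ℕ) by push_cast; ring] at a1
    rw [show 2 * (n + 1) = 2 * n + 1 + 1 by ring, qp_succ, qp_succ]
    have n1 := one_sub_pow_ne hQ (2 * n)
    have n2 := one_sub_pow_ne hQ (2 * n + 1)
    have n3 := qp_ne hQ (2 * n)
    simp only [zpow_natCast] at a1 a2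
    rw [← pow_succ'] at n1 n2
    rw [← pow_succ', ← pow_succ']
    have a3 : TT Q (n + 1 : ℕ) = Q ^ n * (Q ^ n ^ 2 / qp Q Q (2 * n)) / (1 - Q ^ (2 * n + 1)) := by
      rw [eq_div_iff n1, ← a2]; ring
    rw [a3] at a1
    rw [eq_div_iff (by simp [n1, n2, n3])]
    have : SS Q (n + 1 : ℕ) * (1 - Q ^ (2 * n + 1 + 1)) * ((1 - Q ^ (2 * n + 1)) * qp Q Q (2 * n))
       = Q ^ (n + 1) ^ 2 := by
      rw [mul_comm (SS Q _), a1]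
      field_simp
      ring
    rw [← this]; ring

lemma VV_eq {Q : ℂ} (h0 : 0 < ‖Q‖) (hQ : ‖Q‖ < 1) (n : ℕ) :
    Q ^ n * VV Q n = Q ^ (n ^ 2) / qp Q Q (2 * n) := by
  rcases Nat.eq_zero_or_pos n with rfl | hn
  · simpa [qp_zero] using VV_zero Q
  · rw [← SS_eq h0 hQ]
    have h := one_sub_zpow_ne hQ (i := 2 * n) (by omega)
    apply mul_left_cancel₀ h
    rw [SS_TT h0 hQ, ← VV_TT h0 hQ, zpow_natCast]
    ring


set_option maxHeartbeats 2000000 in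
/-- Finite Jacobi triple product, one step. -/
lemma jtp_step {s z : ℂ} (hs0 : 0 < ‖s‖) (hs : ‖s‖ < 1) (hz : z ≠ 0)
    (hθ : Summable fun k : ℤ => (-z) ^ k * s ^ (k ^ 2)) (n : ℤ) :
    (1 - z * s ^ (2 * n + 1)) * (1 - z⁻¹ * s ^ (2 * n + 1)) *
      ∑' k : ℤ, (-z) ^ k * s ^ (k ^ 2) * (PP (s ^ 2) (n - k) * PP (s ^ 2) (n + k))
    = (1 - (s ^ 2) ^ (2 * n + 1)) * (1 - (s ^ 2) ^ (2 * n + 2)) *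
      ∑' k : ℤ, (-z) ^ k * s ^ (k ^ 2) * (PP (s ^ 2) (n + 1 - k) * PP (s ^ 2) (n + 1 + k)) := by
  have hs1 : s ≠ 0 := norm_pos_iff.mp hs0
  have hQ : ‖s ^ 2‖ < 1 := by rw [norm_pow]; exact pow_lt_one₀ hs0.le hs (by norm_num)
  have sm := fun u v => summable_PP hQ hθ u v
  set f : ℤ → ℂ := fun k => (-z) ^ k * s ^ (k ^ 2) * (PP (s ^ 2) (n - k) * PP (s ^ 2) (n + k)) with hf
  have sf : Summable f := sm _ _
  have sf1 : Summable fun k : ℤ => f (k + 1) := (Equiv.addRight (1 : ℤ)).summable_iff.mpr sf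
  have sf2 : Summable fun k : ℤ => f (k + -1) := (Equiv.addRight (-1 : ℤ)).summable_iff.mpr sf
  have key : (1 - z * s ^ (2 * n + 1)) * (1 - z⁻¹ * s ^ (2 * n + 1)) * ∑' k, f k
      = (1 + (s ^ (2 * n + 1)) ^ 2) * ∑' k, f k + (-z⁻¹ * s ^ (2 * n + 1)) * ∑' k, f (k + 1)
        + (-z * s ^ (2 * n + 1)) * ∑' k, f (k + -1) := by
    rw [tsum_shift f 1, tsum_shift f (-1)]
    have : z * z⁻¹ = 1 := mul_inv_cancel₀ hz
    linear_combination (s ^ (2 * n + 1)) ^ 2 * (∑' k, f k) * this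
  rw [key, ← tsum_mul_left, ← tsum_mul_left, ← tsum_mul_left,
    ← Summable.tsum_add (sf.mul_left _) (sf1.mul_left _),
    ← Summable.tsum_add ((sf.mul_left _).add (sf1.mul_left _)) (sf2.mul_left _), ← tsum_mul_left]
  refine tsum_congr fun k => ?_
  simp only [hf]
  have q1 : PP (s ^ 2) (n - k) = (1 - (s ^ 2) ^ (n + 1 - k)) * PP (s ^ 2) (n + 1 - k) := by
    rw [← PP_step hQ]; congr 1; ring
  have q2 : PP (s ^ 2) (n + k) = (1 - (s ^ 2) ^ (n + 1 + k)) * PP (s ^ 2) (n + 1 + k) := by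
    rw [← PP_step hQ]; congr 1; ring
  have q3 : PP (s ^ 2) (n - (k + 1)) = (1 - (s ^ 2) ^ (n - k)) * PP (s ^ 2) (n - k) := by
    rw [← PP_step hQ]; congr 1; ring
  have q4 : PP (s ^ 2) (n + (k + -1)) = (1 - (s ^ 2) ^ (n + k)) * PP (s ^ 2) (n + k) := by
    rw [← PP_step hQ]; congr 1; ring
  have q5 : n + (k + 1) = n + 1 + k := by ring
  have q6 : n - (k + -1) = n + 1 - k := by ring
  rw [q3, q4, q5, q6, q1, q2]
  have hz' : -z ≠ 0 := neg_ne_zero.mpr hz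
  have hQ0 : s ^ 2 ≠ 0 := pow_ne_zero _ hs1
  have z1 : (-z) ^ (k + 1) = (-z) ^ k * (-z) := zpow_add_one₀ hz' k
  have z2 : (-z) ^ (k + -1) = (-z) ^ k * (-z)⁻¹ := zpow_sub_one₀ hz' k
  have z3 : s ^ ((k + 1) ^ 2) = s ^ (k ^ 2) * (s ^ k * s ^ k * s) := by
    rw [← zpow_add₀ hs1, ← zpow_add_one₀ hs1, ← zpow_add₀ hs1]; congr 1; ring
  have z4 : s ^ ((k + -1) ^ 2) = s ^ (k ^ 2) * ((s ^ k)⁻¹ * (s ^ k)⁻¹ * s) := by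
    rw [← zpow_neg, ← zpow_add₀ hs1, ← zpow_add_one₀ hs1, ← zpow_add₀ hs1]; congr 1; ring
  have hsq : ∀ m : ℤ, (s ^ 2) ^ m = s ^ m * s ^ m := fun m => by
    rw [← mul_zpow, sq]
  rw [z1, z2, z3, z4]
  simp only [hsq]
  have y1 : s ^ (2 * n + 1) = s ^ n * s ^ n * s := by
    rw [← zpow_add₀ hs1, ← zpow_add_one₀ hs1]; congr 1; ring
  have y2 : s ^ (2 * n + 2) = s ^ n * s ^ n * s * s := by
    rw [← zpow_add₀ hs1, ← zpow_add_one₀ hs1, ← zpow_add_one₀ hs1]; congr 1; ring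
  have y3 : s ^ (n + 1 - k) = s ^ n * s * (s ^ k)⁻¹ := by
    rw [← zpow_add_one₀ hs1, ← zpow_neg, ← zpow_add₀ hs1]; congr 1
  have y4 : s ^ (n + 1 + k) = s ^ n * s * (s ^ k) := by
    rw [← zpow_add_one₀ hs1, ← zpow_add₀ hs1]
  have y5 : s ^ (n - k) = s ^ n * (s ^ k)⁻¹ := by
    rw [← zpow_neg, ← zpow_add₀ hs1]; congr 1
  have y6 : s ^ (n + k) = s ^ n * (s ^ k) := zpow_add₀ hs1 _ _
  rw [y1, y2, y3, y4, y5, y6]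
  have hk : s ^ k ≠ 0 := zpow_ne_zero _ hs1
  generalize s ^ k = x at *
  generalize s ^ n = y at *
  generalize s ^ k ^ 2 = u at *
  generalize (-z) ^ k = v at *
  generalize PP (s ^ 2) (n + 1 - k) = A at *
  generalize PP (s ^ 2) (n + 1 + k) = B at *
  field_simp
  ring

lemma jtp {s z : ℂ} (hs0 : 0 < ‖s‖) (hs : ‖s‖ < 1) (hz : z ≠ 0)
    (hθ : Summable fun k : ℤ => (-z) ^ k * s ^ (k ^ 2)) :
    tp (s ^ 2) (z * s) (z⁻¹ * s) = ∑' k : ℤ, (-z) ^ k * s ^ (k ^ 2) := by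
  have hQ : ‖s ^ 2‖ < 1 := by rw [norm_pow]; exact pow_lt_one₀ hs0.le hs (by norm_num)
  have fin : ∀ n : ℕ, qp (s ^ 2) (s ^ 2) (2 * n) *
      ∑' k : ℤ, (-z) ^ k * s ^ (k ^ 2) * (PP (s ^ 2) (n - k) * PP (s ^ 2) (n + k))
      = qp (s ^ 2) (z * s) n * qp (s ^ 2) (z⁻¹ * s) n := by
    intro n
    induction n with
    | zero =>
      rw [tsum_eq_single 0]
      · simp [PP, qp_zero]
      · intro k hk
        rcases lt_or_gt_of_ne hk with h | h
        · rw [PP_neg _ (c := ((0 : ℕ) : ℤ) + k) (by simpa using h)]; simp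
        · rw [PP_neg _ (c := ((0 : ℕ) : ℤ) - k) (by simpa using h)]; simp
    | succ n ih =>
      have st := jtp_step hs0 hs hz hθ n
      rw [show 2 * (n + 1) = 2 * n + 1 + 1 by ring, qp_succ, qp_succ, qp_succ, qp_succ]
      push_cast
      rw [show (2 * (n : ℤ) + 1) = ((2 * n + 1 : ℕ) : ℤ) by push_cast; ring,
        show (2 * (n : ℤ) + 2) = ((2 * n + 2 : ℕ) : ℤ) by push_cast; ring] at st
      simp only [zpow_natCast] at st
      have t1 : z * s * (s ^ 2) ^ n = z * s ^ (2 * n + 1) := by ring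
      have t2 : z⁻¹ * s * (s ^ 2) ^ n = z⁻¹ * s ^ (2 * n + 1) := by ring
      rw [t1, t2]
      have t3 : s ^ 2 * (s ^ 2) ^ (2 * n) = (s ^ 2) ^ (2 * n + 1) := by ring
      have t4 : s ^ 2 * (s ^ 2) ^ (2 * n + 1) = (s ^ 2) ^ (2 * n + 2) := by ring
      rw [t3, t4]
      linear_combination (1 - z * s ^ (2 * n + 1)) * (1 - z⁻¹ * s ^ (2 * n + 1)) * ih
        - qp (s ^ 2) (s ^ 2) (2 * n) * st
  obtain ⟨K, hK0, hK⟩ := PP_bdd hQ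
  have lim1 : Tendsto (fun n : ℕ => ∑' k : ℤ, (-z) ^ k * s ^ (k ^ 2) *
      (PP (s ^ 2) (n - k) * PP (s ^ 2) (n + k))) atTop
      (𝓝 (∑' k : ℤ, (-z) ^ k * s ^ (k ^ 2) *
        ((qpInf (s ^ 2) (s ^ 2))⁻¹ * (qpInf (s ^ 2) (s ^ 2))⁻¹))) := by
    refine tendsto_tsum_of_dominated_convergence (hθ.norm.mul_right (K * K)) ?_ ?_
    · intro k
      refine Tendsto.const_mul _ (Tendsto.mul ?_ ?_)
      · exact (PP_tendsto hQ).comp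
          (tendsto_atTop_add_const_right _ (-k) tendsto_natCast_atTop_atTop)
      · exact (PP_tendsto hQ).comp
          (tendsto_atTop_add_const_right _ k tendsto_natCast_atTop_atTop)
    · refine Eventually.of_forall fun n k => ?_
      rw [norm_mul, norm_mul (PP _ _)]
      gcongr
      · exact hK _
      · exact hK _
  have lim2 : Tendsto (fun n : ℕ => qp (s ^ 2) (s ^ 2) (2 * n)) atTop
      (𝓝 (qpInf (s ^ 2) (s ^ 2))) :=
    (qp_tendsto hQ _).comp (tendsto_id.const_mul_atTop' (by norm_num : 0 < 2))
  have lim3 := lim2.mul lim1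
  simp only [fin] at lim3
  have lim4 := (qp_tendsto hQ (z * s)).mul (qp_tendsto hQ (z⁻¹ * s))
  have e := tendsto_nhds_unique lim4 lim3
  rw [tsum_mul_right] at e
  unfold tp
  rw [e]
  have := qpInf_ne hQ
  field_simp

noncomputable def ww (q : ℂ) (n : ℕ) : ℂ := (-1) ^ n * qp (q ^ 2) q n * q ^ (n ^ 2)

noncomputable def GG (q : ℂ) (r : ℤ) : ℂ :=
  ∑' n : ℕ, ww q n * (PP (q ^ 2) (n - r) * PP (q ^ 2) (n + r))

lemma summable_ww {q : ℂ} (h0 : 0 < ‖q‖) (h1 : ‖q‖ < 1) : Summable (ww q) := by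
  have hQ : ‖q ^ 2‖ < 1 := by rw [norm_pow]; exact pow_lt_one₀ h0.le h1 (by norm_num)
  obtain ⟨K, hK0, hK⟩ := qp_bdd hQ q
  refine Summable.of_norm_bounded ((summable_geometric_of_lt_one h0.le h1).mul_left K) fun n => ?_
  rw [ww, norm_mul, norm_mul, norm_pow, norm_neg, norm_one, one_pow, one_mul, norm_pow]
  exact mul_le_mul (hK _) (pow_le_pow_of_le_one h0.le h1.le (by nlinarith))
    (pow_nonneg h0.le _) hK0

lemma GG_step {q : ℂ} (h0 : 0 < ‖q‖) (h1 : ‖q‖ < 1) (r : ℕ) :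
    GG q (r + 1) = - q ^ (2 * r + 1) * GG q r := by
  have hq : q ≠ 0 := norm_pos_iff.mp h0
  have hQ0 : q ^ 2 ≠ 0 := pow_ne_zero _ hq
  have hQ : ‖q ^ 2‖ < 1 := by rw [norm_pow]; exact pow_lt_one₀ h0.le h1 (by norm_num)
  have sm := fun u v => summable_PP hQ (summable_ww h0 h1) u v
  set U : ℕ → ℂ := fun n => ww q n * (PP (q ^ 2) (n - r - 1) * PP (q ^ 2) (n + r)) with hU
  have sU : Summable U := sm _ _
  have sU1 : Summable fun n => U (n + 1) := (summable_nat_add_iff 1).mpr sU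
  have tU : ∑' n, U (n + 1) = ∑' n, U n := by
    rw [sU.tsum_eq_zero_add]
    have : U 0 = 0 := by
      simp only [hU]
      rw [PP_neg _ (by push_cast; omega)]; simp
    rw [this, zero_add]
  have key : GG q (r + 1) + q ^ (2 * r + 1) * GG q r
      = (1 + q ^ (2 * r + 1)) * (∑' n, U n) - (1 + q ^ (2 * r + 1)) * ∑' n, U (n + 1) := by
    unfold GG
    rw [← tsum_mul_left, ← tsum_mul_left, ← tsum_mul_left,
      ← Summable.tsum_add (sm _ _) ((sm _ _).mul_left _),
      ← Summable.tsum_sub (sU.mul_left _) (sU1.mul_left _)]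
    refine tsum_congr fun n => ?_
    simp only [hU]
    have w1 : ww q (n + 1) = - ww q n * (1 - q * (q ^ n) ^ 2) * (q * (q ^ n) ^ 2) := by
      unfold ww
      rw [qp_succ]; ring
    have p1 : PP (q ^ 2) (n - (r + 1)) = (1 - (q ^ 2) ^ ((n : ℤ) - r)) * PP (q ^ 2) (n - r) := by
      rw [← PP_step hQ]; congr 1; ring
    have p2 : PP (q ^ 2) (n - r - 1) = (1 - (q ^ 2) ^ ((n : ℤ) - r)) * PP (q ^ 2) (n - r) := by
      rw [← PP_step hQ]
    have p3 : PP (q ^ 2) (n + r) = (1 - (q ^ 2) ^ ((n : ℤ) + (r + 1))) * PP (q ^ 2) (n + (r + 1)) := by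
      rw [← PP_step hQ]; congr 1; ring
    have p4 : ((n + 1 : ℕ) : ℤ) - r - 1 = n - r := by push_cast; ring
    have p5 : ((n + 1 : ℕ) : ℤ) + r = n + (r + 1) := by push_cast; ring
    rw [w1, p4, p5, p1, p2, p3]
    have y1 : (q ^ 2) ^ ((n : ℤ) - r) = (q ^ n) ^ 2 / (q ^ r) ^ 2 := by
      rw [zpow_sub₀ hQ0, zpow_natCast, zpow_natCast]; ring
    have y2 : (q ^ 2) ^ ((n : ℤ) + (r + 1)) = (q ^ n) ^ 2 * (q ^ r) ^ 2 * q ^ 2 := by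
      rw [show (n : ℤ) + (r + 1) = ((n + (r + 1) : ℕ) : ℤ) by push_cast; ring, zpow_natCast]; ring
    have y3 : q ^ (2 * r + 1) = (q ^ r) ^ 2 * q := by ring
    rw [y1, y2, y3]
    have hk : q ^ r ≠ 0 := pow_ne_zero _ hq
    generalize q ^ r = x at *
    generalize q ^ n = y at *
    field_simp
    ring
  rw [tU] at key
  linear_combination key

lemma GG_nat {q : ℂ} (h0 : 0 < ‖q‖) (h1 : ‖q‖ < 1) (r : ℕ) :
    GG q r = (-1) ^ r * q ^ (r ^ 2) * GG q 0 := by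
  induction r with
  | zero => simp
  | succ r ih =>
    push_cast
    rw [GG_step h0 h1, ih]; ring

lemma GG_shift {q : ℂ} (h0 : 0 < ‖q‖) (h1 : ‖q‖ < 1) (r : ℕ) :
    GG q r = (-1) ^ r * q ^ (r ^ 2) * ∑' m : ℕ, (-1) ^ m * qp (q ^ 2) q (m + r) * q ^ (m ^ 2) *
      q ^ (2 * m * r) * (PP (q ^ 2) m * PP (q ^ 2) (m + 2 * r)) := by
  have hQ : ‖q ^ 2‖ < 1 := by rw [norm_pow]; exact pow_lt_one₀ h0.le h1 (by norm_num)
  unfold GG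
  rw [← (summable_PP hQ (summable_ww h0 h1) _ _).sum_add_tsum_nat_add r, Finset.sum_eq_zero,
    zero_add, ← tsum_mul_left]
  · refine tsum_congr fun m => ?_
    rw [show ((m + r : ℕ) : ℤ) - r = m by push_cast; ring,
      show ((m + r : ℕ) : ℤ) + r = m + 2 * r by push_cast; ring, ww]
    ring
  · intro n hn
    rw [Finset.mem_range] at hn
    rw [PP_neg _ (by omega)]; simp

lemma GG_zero {q : ℂ} (h0 : 0 < ‖q‖) (h1 : ‖q‖ < 1) :
    GG q 0 = qpInf (q ^ 2) q / qpInf (q ^ 2) (q ^ 2) := by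
  have hq : q ≠ 0 := norm_pos_iff.mp h0
  have hQ : ‖q ^ 2‖ < 1 := by rw [norm_pow]; exact pow_lt_one₀ h0.le h1 (by norm_num)
  obtain ⟨K, hK0, hK⟩ := PP_bdd hQ
  obtain ⟨L, hL0, hL⟩ := qp_bdd hQ q
  have hc : ∀ r : ℕ, ∑' m : ℕ, (-1) ^ m * qp (q ^ 2) q (m + r) * q ^ (m ^ 2) *
      q ^ (2 * m * r) * (PP (q ^ 2) m * PP (q ^ 2) (m + 2 * r)) = GG q 0 := by
    intro r
    have a1 := GG_nat h0 h1 r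
    rw [GG_shift h0 h1] at a1
    refine mul_left_cancel₀ ?_ a1
    exact mul_ne_zero (pow_ne_zero _ (by norm_num)) (pow_ne_zero _ hq)
  have lim : Tendsto (fun r : ℕ => ∑' m : ℕ, (-1) ^ m * qp (q ^ 2) q (m + r) * q ^ (m ^ 2) *
      q ^ (2 * m * r) * (PP (q ^ 2) m * PP (q ^ 2) (m + 2 * r))) atTop
      (𝓝 (∑' m : ℕ, if m = 0 then qpInf (q ^ 2) q * (qpInf (q ^ 2) (q ^ 2))⁻¹ else 0)) := by
    refine tendsto_tsum_of_dominated_convergence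
      (bound := fun m => L * ‖q‖ ^ m * (K * K))
      (((summable_geometric_of_lt_one h0.le h1).mul_left L).mul_right _) ?_ ?_
    · intro m
      have lq : Tendsto (fun r : ℕ => qp (q ^ 2) q (m + r)) atTop (𝓝 (qpInf (q ^ 2) q)) := by
        simpa only [add_comm m] using (tendsto_add_atTop_iff_nat m).mpr (qp_tendsto hQ q)
      have lp : Tendsto (fun r : ℕ => PP (q ^ 2) ((m : ℤ) + 2 * r)) atTop
          (𝓝 (qpInf (q ^ 2) (q ^ 2))⁻¹) := by
        refine (PP_tendsto hQ).comp ?_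
        refine tendsto_atTop_add_const_left _ _ ?_
        exact tendsto_natCast_atTop_atTop.const_mul_atTop' (by norm_num : (0 : ℤ) < 2)
      rcases Nat.eq_zero_or_pos m with rfl | hm
      · have := lq.mul lp
        simpa [PP, qp_zero] using this
      · rw [if_neg (by omega)]
        have lz : Tendsto (fun r : ℕ => q ^ (2 * m * r)) atTop (𝓝 0) := by
          simp only [pow_mul]
          apply tendsto_pow_atTop_nhds_zero_of_norm_lt_one
          rw [← pow_mul, norm_pow]
          exact pow_lt_one₀ h0.le h1 (by omega)
        have := (((lq.const_mul ((-1) ^ m)).mul_const (q ^ (m ^ 2))).mul lz).mul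
          (lp.const_mul (PP (q ^ 2) m))
        simpa using this
    · refine Eventually.of_forall fun r m => ?_
      rw [norm_mul, norm_mul (PP _ _), norm_mul, norm_mul, norm_mul, norm_pow, norm_neg, norm_one,
        one_pow, one_mul, norm_pow, norm_pow]
      have b1 : ‖q‖ ^ (m ^ 2) ≤ ‖q‖ ^ m := pow_le_pow_of_le_one h0.le h1.le (by nlinarith)
      have b2 : ‖q‖ ^ (2 * m * r) ≤ 1 := pow_le_one₀ h0.le h1.le
      calc _ ≤ L * ‖q‖ ^ m * 1 * (K * K) := by
            gcongr
            · exact hL _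
            · exact hK _
            · exact hK _
        _ = _ := by ring
  simp only [hc] at lim
  rw [tendsto_nhds_unique tendsto_const_nhds lim, tsum_ite_eq, div_eq_mul_inv]

lemma GG_eq {q : ℂ} (h0 : 0 < ‖q‖) (h1 : ‖q‖ < 1) (r : ℤ) :
    GG q r = (-1) ^ r * q ^ (r ^ 2) * (qpInf (q ^ 2) q / qpInf (q ^ 2) (q ^ 2)) := by
  rw [← GG_zero h0 h1]
  obtain ⟨n, rfl | rfl⟩ := r.eq_nat_or_neg
  · rw [GG_nat h0 h1, zpow_natCast]; norm_cast
  · have : GG q (-n) = GG q n := by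
      unfold GG
      refine tsum_congr fun m => ?_
      rw [mul_comm (PP _ _)]
      congr 3
      ring
    rw [this, GG_nat h0 h1, zpow_neg, zpow_natCast, neg_sq, ← inv_pow, inv_neg, inv_one]
    norm_cast

set_option maxHeartbeats 2000000 in
/-- Interchange of summation. -/
lemma swap {q : ℂ} (h0 : 0 < ‖q‖) (h1 : ‖q‖ < 1) {g : ℤ → ℂ} (hg : Summable g) (r : ℤ → ℤ) :
    Summable (fun n : ℕ => ww q n * ∑' k : ℤ, g k * (PP (q ^ 2) (n - r k) * PP (q ^ 2) (n + r k))) ∧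
    ∑' n : ℕ, ww q n * ∑' k : ℤ, g k * (PP (q ^ 2) (n - r k) * PP (q ^ 2) (n + r k))
      = (qpInf (q ^ 2) q / qpInf (q ^ 2) (q ^ 2)) * ∑' k : ℤ, g k * ((-1) ^ (r k) * q ^ (r k ^ 2)) := by
  have hQ : ‖q ^ 2‖ < 1 := by rw [norm_pow]; exact pow_lt_one₀ h0.le h1 (by norm_num)
  have s1 : Summable fun p : ℕ × ℤ => ww q p.1 * g p.2 :=
    summable_mul_of_summable_norm (summable_ww h0 h1).norm hg.norm
  have s2 := summable_PP hQ s1 (fun p => p.1 - r p.2) (fun p => p.1 + r p.2)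
  have e1 : ∀ n : ℕ, ww q n * ∑' k : ℤ, g k * (PP (q ^ 2) (n - r k) * PP (q ^ 2) (n + r k))
      = ∑' k : ℤ, ww q n * g k * (PP (q ^ 2) (n - r k) * PP (q ^ 2) (n + r k)) := fun n => by
    rw [← tsum_mul_left]
    exact tsum_congr fun k => by ring
  simp only [e1]
  refine ⟨s2.prod, ?_⟩
  rw [← Summable.tsum_comm (f := fun (n : ℕ) (k : ℤ) => ww q n * g k *
    (PP (q ^ 2) (n - r k) * PP (q ^ 2) (n + r k))) s2, ← tsum_mul_left]
  refine tsum_congr fun k => ?_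
  have := GG_eq h0 h1 (r k)
  calc _ = g k * GG q (r k) := by
        rw [GG, ← tsum_mul_left]
        exact tsum_congr fun n => by ring
    _ = _ := by rw [this]; ring


lemma jt {q : ℂ} (h0 : 0 < ‖q‖) (h1 : ‖q‖ < 1) (b x y : ℕ) (hx : x + b = 15) (hy : y = 15 + b) :
    tp (q ^ 30) (q ^ x) (q ^ y) = ∑' k : ℤ, (-1) ^ k * q ^ (15 * k ^ 2 + (-b) * k + 0) := by
  have hq : q ≠ 0 := norm_pos_iff.mp h0
  have hs0 : 0 < ‖q ^ 15‖ := by rw [norm_pow]; positivity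
  have hs : ‖q ^ 15‖ < 1 := by rw [norm_pow]; exact pow_lt_one₀ h0.le h1 (by norm_num)
  have hb : q ^ b ≠ 0 := pow_ne_zero _ hq
  have e : ∀ k : ℤ, (-(q ^ b)⁻¹) ^ k * (q ^ 15) ^ (k ^ 2)
      = (-1) ^ k * q ^ (15 * k ^ 2 + (-b) * k + 0) := by
    intro k
    rw [neg_eq_neg_one_mul, mul_zpow, ← zpow_natCast q b, ← zpow_neg, ← zpow_mul,
      ← zpow_natCast q 15, ← zpow_mul, mul_assoc, ← zpow_add₀ hq]
    congr 2
    push_cast; ring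
  have sm : Summable fun k : ℤ => (-(q ^ b)⁻¹) ^ k * (q ^ 15) ^ (k ^ 2) := by
    simp only [e]
    refine Summable.of_norm_bounded (summable_sq h0 h1 15 (-b) 0 (by norm_num)).norm fun k => ?_
    rw [norm_mul, norm_zpow, norm_neg, norm_one, one_zpow, one_mul]
  have := jtp hs0 hs (inv_ne_zero hb) sm
  simp only [e] at this
  rw [← this, ← pow_mul, inv_inv]
  have e1 : (q ^ b)⁻¹ * q ^ 15 = q ^ x := by
    rw [← hx, pow_add]; field_simp
  have e2 : q ^ b * q ^ 15 = q ^ y := by rw [hy, pow_add, mul_comm]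
  rw [e1, e2]

lemma fam {q : ℂ} (h0 : 0 < ‖q‖) (b c d e : ℤ) (r : ℤ → ℤ) (σ : ℂ)
    (hr : ∀ k, (-1 : ℂ) ^ (r k) = σ * (-1) ^ k)
    (he : ∀ k, 2 * (3 * k ^ 2 + b * k + c) + r k ^ 2 = d + (15 * k ^ 2 + e * k + 0)) :
    ∑' k : ℤ, (q ^ 2) ^ (3 * k ^ 2 + b * k + c) * ((-1) ^ (r k) * q ^ (r k ^ 2))
      = σ * q ^ d * ∑' k : ℤ, (-1) ^ k * q ^ (15 * k ^ 2 + e * k + 0) := by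
  have hq : q ≠ 0 := norm_pos_iff.mp h0
  rw [← tsum_mul_left]
  refine tsum_congr fun k => ?_
  have h : (q ^ 2) ^ (3 * k ^ 2 + b * k + c) * q ^ (r k ^ 2)
      = q ^ d * q ^ (15 * k ^ 2 + e * k + 0) := by
    rw [← zpow_natCast q 2, ← zpow_mul, ← zpow_add₀ hq, ← zpow_add₀ hq, ← he]
    push_cast; rfl
  rw [hr]
  linear_combination σ * (-1) ^ k * h

theorem stmt8 (q : ℂ) (h0 : 0 < ‖q‖) (h1 : ‖q‖ < 1) :
    ∑' n : ℕ, (-1 : ℂ) ^ n * qp (q ^ 2) q n * (q ^ (2 * n) - 1) * q ^ (3 * n ^ 2 - 2 * n) /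
        qp (q ^ 2) (q ^ 2) (2 * n)
      = (qpInf (q ^ 2) q / qpInf (q ^ 2) (q ^ 2)) *
          (tp (q ^ 30) (q ^ 13) (q ^ 17) - tp (q ^ 30) (q ^ 11) (q ^ 19)
            + q * tp (q ^ 30) (q ^ 7) (q ^ 23) - q ^ 3 * tp (q ^ 30) q (q ^ 29)) := by
  have hq : q ≠ 0 := norm_pos_iff.mp h0
  have hQ0 : 0 < ‖q ^ 2‖ := by rw [norm_pow]; positivity
  have hQ : ‖q ^ 2‖ < 1 := by rw [norm_pow]; exact pow_lt_one₀ h0.le h1 (by norm_num)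
  have term : ∀ n : ℕ, (-1 : ℂ) ^ n * qp (q ^ 2) q n * (q ^ (2 * n) - 1) * q ^ (3 * n ^ 2 - 2 * n) /
        qp (q ^ 2) (q ^ 2) (2 * n) = ww q n * (SS (q ^ 2) n - VV (q ^ 2) n) := by
    intro n
    have hn : (q ^ 2) ^ n ≠ 0 := pow_ne_zero _ (pow_ne_zero _ hq)
    apply mul_left_cancel₀ hn
    have v := VV_eq hQ0 hQ n
    have s := SS_eq hQ0 hQ n
    have x : (q ^ 2) ^ n * q ^ (3 * n ^ 2 - 2 * n) = q ^ (n ^ 2) * (q ^ 2) ^ (n ^ 2) := by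
      rw [← pow_mul, ← pow_mul, ← pow_add, ← pow_add]
      congr 1
      have : 2 * n ≤ 3 * n ^ 2 := by nlinarith [Nat.le_self_pow (two_ne_zero) n]
      omega
    rw [show (q ^ 2) ^ n * (ww q n * (SS (q ^ 2) n - VV (q ^ 2) n))
      = ww q n * ((q ^ 2) ^ n * SS (q ^ 2) n - (q ^ 2) ^ n * VV (q ^ 2) n) by ring, v, s, ww,
      pow_mul q 2 n]
    linear_combination (-1) ^ n * qp (q ^ 2) q n * ((q ^ 2) ^ n - 1) /
      qp (q ^ 2) (q ^ 2) (2 * n) * x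
  have sq := fun b c => summable_sq hQ0 hQ 3 b c (by norm_num)
  obtain ⟨a1, b1⟩ := swap h0 h1 (sq (-1) 0) (fun k => 3 * k)
  obtain ⟨a2, b2⟩ := swap h0 h1 (sq (-1) 0) (fun k => 3 * k - 1)
  obtain ⟨a3, b3⟩ := swap h0 h1 (sq (-2) 0) (fun k => 3 * k)
  obtain ⟨a4, b4⟩ := swap h0 h1 (sq (-4) 1) (fun k => 3 * k - 1)
  have r1 : ∀ k : ℤ, (-1 : ℂ) ^ (3 * k) = 1 * (-1) ^ k := fun k => by
    rw [zpow_mul]; norm_num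
  have r2 : ∀ k : ℤ, (-1 : ℂ) ^ (3 * k - 1) = (-1) * (-1) ^ k := fun k => by
    rw [zpow_sub_one₀ (by norm_num), r1]; norm_num
  have f1 := fam h0 (-1) 0 0 (-(2 : ℕ)) (fun k => 3 * k) 1 r1 (fun k => by push_cast; ring)
  have f2 := fam h0 (-1) 0 1 (-(8 : ℕ)) (fun k => 3 * k - 1) (-1) r2 (fun k => by push_cast; ring)
  have f3 := fam h0 (-2) 0 0 (-(4 : ℕ)) (fun k => 3 * k) 1 r1 (fun k => by push_cast; ring)
  have f4 := fam h0 (-4) 1 3 (-(14 : ℕ)) (fun k => 3 * k - 1) (-1) r2 (fun k => by push_cast; ring)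
  have j4 := jt h0 h1 14 1 29 (by norm_num) (by norm_num)
  rw [pow_one] at j4
  rw [← jt h0 h1 2 13 17 (by norm_num) (by norm_num)] at f1
  rw [← jt h0 h1 8 7 23 (by norm_num) (by norm_num)] at f2
  rw [← jt h0 h1 4 11 19 (by norm_num) (by norm_num)] at f3
  rw [← j4] at f4
  rw [f1] at b1
  rw [f2] at b2
  rw [f3] at b3
  rw [f4] at b4
  rw [tsum_congr term]
  simp only [SS, VV, mul_sub]
  rw [Summable.tsum_sub (a1.sub a2) (a3.sub a4), Summable.tsum_sub a1 a2, Summable.tsum_sub a3 a4,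
    b1, b2, b3, b4]
  rw [zpow_zero, zpow_one, show (q : ℂ) ^ (3 : ℤ) = q ^ 3 from zpow_natCast q 3]
  ring
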